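/- arXiv:1405.3422 — 3 statements merged into one kernel-verified Lean document; each statement's English description precedes it below -/
import Mathlib

section
/- Let k ≥ 7 be a natural number and let G be a finite simple graph with maximum degree at most k. Suppose G contains 2p pairwise distinct vertices u_1, v_1, u_2, v_2, …, u_p, v_p with p ≥ 2 forming a cycle, i.e., u_i v_i and v_i u_{i+1} are edges of G for all i (indices modulo p), and suppose every v_i has degree exactly 2 in G. Let L be a list assignment on the edges of G with |L(e)| ≥ k for every edge e. Then every proper L-edge-coloring of the graph obtained from G by deleting the vertices v_1, …, v_p extends to a proper L-edge-coloring of G (agreeing with the given coloring on all edges not incident to any v_i). -/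
/-- A proper `L`-edge-coloring of `G`: every edge of `G` gets a color from its list,
and any two distinct edges of `G` sharing an endpoint receive distinct colors. -/
def IsProperEdgeColoring {V : Type*} (G : SimpleGraph V)
    (L : Sym2 V → Finset ℕ) (c : Sym2 V → ℕ) : Prop :=
  (∀ e ∈ G.edgeSet, c e ∈ L e) ∧
  ∀ e ∈ G.edgeSet, ∀ f ∈ G.edgeSet, e ≠ f → (∃ x, x ∈ e ∧ x ∈ f) → c e ≠ c f

/-- The graph obtained from `G` by deleting the vertices in `S`
(keeping the same ambient vertex type, with deleted vertices isolated). -/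
def deleteVertices {V : Type*} (G : SimpleGraph V) (S : Set V) : SimpleGraph V where
  Adj x y := G.Adj x y ∧ x ∉ S ∧ y ∉ S
  symm := by
    constructor
    intro x y h
    exact ⟨h.1.symm, h.2.2, h.2.1⟩
  loopless := by
    constructor
    intro x h
    exact G.loopless.irrefl x h.1

/-- Lists of size at least two around a cycle of length `n`: a color in the list of `0` which is
missing from the list of `-1` can be completed greedily to a proper coloring of the cycle. -/
theorem exists_cycle_listColoring_of_mem_of_notMem {n : ℕ} [NeZero n]
    (S : ZMod n → Finset ℕ) (hS : ∀ z, 2 ≤ (S z).card) {a : ℕ} (ha : a ∈ S 0)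
    (ha' : a ∉ S (-1)) :
    ∃ f : ZMod n → ℕ, (∀ z, f z ∈ S z) ∧ ∀ z, f z ≠ f (z + 1) := by
  have next : ∀ (z : ZMod n) (b : ℕ), ∃ d ∈ S z, d ≠ b := fun z b =>
    Finset.exists_mem_ne (hS z) b
  choose step step_mem step_ne using next
  let g : ℕ → ℕ := fun m => Nat.rec a (fun m b => step ((m + 1 : ℕ) : ZMod n) b) m
  have g_succ : ∀ m, g (m + 1) = step ((m + 1 : ℕ) : ZMod n) (g m) := fun _ => rfl
  have g_mem : ∀ m : ℕ, g m ∈ S (m : ZMod n) := by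
    rintro (_ | m)
    · simpa [g] using ha
    · rw [g_succ]
      exact step_mem _ _
  have f_mem : ∀ z : ZMod n, g z.val ∈ S z := fun z => by
    simpa using g_mem z.val
  refine ⟨fun z => g z.val, f_mem, fun z => ?_⟩
  by_cases hz : z + 1 = 0
  · have hz' : z = -1 := eq_neg_of_add_eq_zero_left hz
    intro h
    apply ha'
    have hmem := f_mem z
    simp only [hz, ZMod.val_zero] at h
    rw [h, hz'] at hmem
    exact hmem
  · have hlt : z.val + 1 < n := by
      refine lt_of_le_of_ne z.val_lt fun h => hz ?_
      have : ((z.val + 1 : ℕ) : ZMod n) = 0 := by rw [h]; simp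
      simpa using this
    have hval : (z + 1).val = z.val + 1 := by
      have : ((z.val + 1 : ℕ) : ZMod n) = z + 1 := by simp
      rw [← this, ZMod.val_natCast_of_lt hlt]
    simp only [hval, g_succ]
    exact (step_ne _ _).symm

/-- Even cycles are 2-choosable. -/
theorem exists_even_cycle_listColoring {n : ℕ} [NeZero n] (hn : Even n)
    (S : ZMod n → Finset ℕ) (hS : ∀ z, 2 ≤ (S z).card) :
    ∃ f : ZMod n → ℕ, (∀ z, f z ∈ S z) ∧ ∀ z, f z ≠ f (z + 1) := by
  by_cases hsub : ∀ z, S z ⊆ S (z - 1)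
  · have hsub' : ∀ m : ℕ, S 0 ⊆ S (-(m : ZMod n)) := by
      intro m
      induction m with
      | zero => simp
      | succ m ih =>
        refine ih.trans ((hsub _).trans_eq ?_)
        congr 1
        push_cast
        ring
    have hsub'' : ∀ z, S 0 ⊆ S z := fun z => by
      simpa using hsub' (-z).val
    obtain ⟨a, ha, b, hb, hab⟩ := Finset.one_lt_card.1 (hS 0)
    let φ : ZMod n →+* ZMod 2 := ZMod.castHom hn.two_dvd (ZMod 2)
    refine ⟨fun z => if φ z = 0 then a else b, fun z => ?_, fun z => ?_⟩
    · dsimp only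
      split_ifs
      · exact hsub'' z ha
      · exact hsub'' z hb
    · simp only [map_add, map_one]
      have hparity : ∀ t : ZMod 2, (t = 0 ∧ t + 1 ≠ 0) ∨ (t ≠ 0 ∧ t + 1 = 0) := by decide
      rcases hparity (φ z) with ⟨h, h'⟩ | ⟨h, h'⟩
      · rw [if_pos h, if_neg h']
        exact hab
      · rw [if_neg h, if_pos h']
        exact hab.symm
  · push Not at hsub
    obtain ⟨z₀, hz₀⟩ := hsub
    obtain ⟨a, ha, ha'⟩ := Finset.not_subset.1 hz₀
    obtain ⟨f, hf, hf'⟩ := exists_cycle_listColoring_of_mem_of_notMem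
      (fun z => S (z + z₀)) (fun z => hS _) (a := a) (by simpa using ha)
      (by simpa [neg_add_eq_sub] using ha')
    refine ⟨fun z => f (z - z₀), fun z => by simpa using hf (z - z₀), fun z => ?_⟩
    have := hf' (z - z₀)
    rwa [sub_add_eq_add_sub] at this

/-- 2-choosability of the cycle of length `2 * p` whose two colour classes are indexed
by `ZMod p`. -/
theorem exists_alternating_cycle_listColoring {p : ℕ} [NeZero p] (A B : ZMod p → Finset ℕ)
    (hA : ∀ i, 2 ≤ (A i).card) (hB : ∀ i, 2 ≤ (B i).card) :
    ∃ x y : ZMod p → ℕ, (∀ i, x i ∈ A i) ∧ (∀ i, y i ∈ B i) ∧ (∀ i, x i ≠ y i) ∧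
      ∀ i, y i ≠ x (i + 1) := by
  let S : ZMod (2 * p) → Finset ℕ := fun z =>
    if z.val % 2 = 0 then A (z.val / 2 : ℕ) else B (z.val / 2 : ℕ)
  obtain ⟨f, hf, hf'⟩ := exists_even_cycle_listColoring (even_two_mul p) S (fun z => by
    dsimp only [S]
    split_ifs
    exacts [hA _, hB _])
  refine ⟨fun i => f (2 * i.val : ℕ), fun i => f (2 * i.val + 1 : ℕ), fun i => ?_, fun i => ?_,
    fun i => ?_, fun i => ?_⟩
  · have hi := i.val_lt
    have h := hf (2 * i.val : ℕ)
    dsimp only [S] at h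
    rw [ZMod.val_natCast_of_lt (by omega), if_pos (by omega),
      Nat.mul_div_cancel_left _ two_pos, ZMod.natCast_zmod_val] at h
    exact h
  · have hi := i.val_lt
    have h := hf (2 * i.val + 1 : ℕ)
    dsimp only [S] at h
    rw [ZMod.val_natCast_of_lt (by omega), if_neg (by omega),
      show (2 * i.val + 1) / 2 = i.val by omega, ZMod.natCast_zmod_val] at h
    exact h
  · have h := hf' (2 * i.val : ℕ)
    rwa [← Nat.cast_succ] at h
  · have h := hf' (2 * i.val + 1 : ℕ)
    have hmod : (i + 1).val ≡ i.val + 1 [MOD p] := by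
      rw [← ZMod.natCast_eq_natCast_iff]
      simp
    have hcast : ((2 * (i + 1).val : ℕ) : ZMod (2 * p)) =
        ((2 * i.val + 1 : ℕ) : ZMod (2 * p)) + 1 := by
      rw [← Nat.cast_succ, ZMod.natCast_eq_natCast_iff]
      exact hmod.mul_left' 2
    dsimp only
    rwa [hcast]

open Classical in
/-- The colors of the list `l` not used by `c` on the edges joining `w` to vertices outside `S`. -/
noncomputable def availableColors {V : Type*} [Fintype V] (G : SimpleGraph V)
    (S : Set V) (c : Sym2 V → ℕ) (l : Finset ℕ) (w : V) : Finset ℕ :=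
  l \ ({z | G.Adj w z ∧ z ∉ S} : Finset V).image fun z => c s(w, z)

theorem mem_availableColors {V : Type*} [Fintype V] {G : SimpleGraph V} {S : Set V}
    {c : Sym2 V → ℕ} {l : Finset ℕ} {w : V} {a : ℕ} :
    a ∈ availableColors G S c l w ↔ a ∈ l ∧ ∀ z, G.Adj w z → z ∉ S → c s(w, z) ≠ a := by
  simp [availableColors]

/-- If `w` has two distinct neighbours in `S`, at least two colors of a list of size at least the
degree of `w` are available. -/
theorem two_le_card_availableColors {V : Type*} [Fintype V] {G : SimpleGraph V}
    [DecidableRel G.Adj] {S : Set V} {c : Sym2 V → ℕ} {l : Finset ℕ} {w s t : V}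
    (hl : G.degree w ≤ l.card) (hs : G.Adj w s) (ht : G.Adj w t) (hsS : s ∈ S) (htS : t ∈ S)
    (hst : s ≠ t) : 2 ≤ (availableColors G S c l w).card := by
  classical
  have hdisj : Disjoint ({z | G.Adj w z ∧ z ∉ S} : Finset V) {s, t} := by
    rw [Finset.disjoint_left]
    intro z hz hz'
    simp only [Finset.mem_filter, Finset.mem_insert, Finset.mem_singleton] at hz hz'
    rcases hz' with rfl | rfl <;> tauto
  have hsub : ({z | G.Adj w z ∧ z ∉ S} : Finset V) ∪ {s, t} ⊆ G.neighborFinset w := by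
    intro z hz
    simp only [Finset.mem_union, Finset.mem_filter, Finset.mem_insert,
      Finset.mem_singleton] at hz
    rw [SimpleGraph.mem_neighborFinset]
    rcases hz with hz | rfl | rfl
    exacts [hz.2.1, hs, ht]
  have hcard := Finset.card_le_card hsub
  rw [Finset.card_union_of_disjoint hdisj, Finset.card_pair hst,
    SimpleGraph.card_neighborFinset_eq_degree] at hcard
  have himage := Finset.card_image_le (s := ({z | G.Adj w z ∧ z ∉ S} : Finset V))
    (f := fun z => c s(w, z))
  have hsdiff := Finset.le_card_sdiff
    (({z | G.Adj w z ∧ z ∉ S} : Finset V).image fun z => c s(w, z)) l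
  have htwo : 2 ≤ (l \ ({z | G.Adj w z ∧ z ∉ S} : Finset V).image fun z => c s(w, z)).card := by
    omega
  unfold availableColors
  convert htwo

theorem stmt_2 {V : Type*} [Fintype V] [DecidableEq V]
    (G : SimpleGraph V) [DecidableRel G.Adj]
    (k : ℕ) (hk : 7 ≤ k) (hΔ : ∀ w, G.degree w ≤ k)
    (p : ℕ) (hp : 2 ≤ p) (u v : ZMod p → V)
    (hu : Function.Injective u) (hv : Function.Injective v)
    (huv : ∀ i j, u i ≠ v j)
    (hadj : ∀ i : ZMod p, G.Adj (u i) (v i) ∧ G.Adj (v i) (u (i + 1)))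
    (hdeg : ∀ i, G.degree (v i) = 2)
    (L : Sym2 V → Finset ℕ) (hL : ∀ e ∈ G.edgeSet, k ≤ (L e).card)
    (c' : Sym2 V → ℕ)
    (hc' : IsProperEdgeColoring (deleteVertices G (Set.range v)) L c') :
    ∃ c : Sym2 V → ℕ, IsProperEdgeColoring G L c ∧
      ∀ e ∈ (deleteVertices G (Set.range v)).edgeSet, c e = c' e := by
  classical
  have : NeZero p := ⟨by omega⟩
  have : Fact (1 < p) := ⟨hp⟩
  have succ_ne : ∀ i : ZMod p, i ≠ i + 1 := fun i => by simp
  obtain ⟨x, y, hx, hy, hxy, hyx⟩ := exists_alternating_cycle_listColoring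
    (fun i => availableColors G (Set.range v) c' (L s(u i, v i)) (u i))
    (fun i => availableColors G (Set.range v) c' (L s(v i, u (i + 1))) (u (i + 1)))
    (fun i => by
      have hprev : G.Adj (v (i - 1)) (u i) := by simpa using (hadj (i - 1)).2
      refine two_le_card_availableColors ((hΔ _).trans (hL _ (hadj i).1)) (hadj i).1 hprev.symm
        ⟨_, rfl⟩ ⟨_, rfl⟩ (hv.ne ?_)
      simpa using (succ_ne (i - 1)).symm)
    (fun i => two_le_card_availableColors ((hΔ _).trans (hL _ (hadj i).2)) (hadj i).2.symm
      (hadj (i + 1)).1 ⟨_, rfl⟩ ⟨_, rfl⟩ (hv.ne (succ_ne i)))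
  simp only [mem_availableColors] at hx hy
  have nbr : ∀ i w, G.Adj (v i) w → w = u i ∨ w = u (i + 1) := by
    intro i w hw
    have hsub : ({u i, u (i + 1)} : Finset V) ⊆ G.neighborFinset (v i) := by
      intro z hz
      simp only [Finset.mem_insert, Finset.mem_singleton] at hz
      rw [SimpleGraph.mem_neighborFinset]
      rcases hz with rfl | rfl
      exacts [(hadj i).1.symm, (hadj i).2]
    have heq := Finset.eq_of_subset_of_card_le hsub (by
      rw [Finset.card_pair (hu.ne (succ_ne i)), SimpleGraph.card_neighborFinset_eq_degree, hdeg])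
    have hmem : w ∈ G.neighborFinset (v i) := by rwa [SimpleGraph.mem_neighborFinset]
    rw [← heq] at hmem
    simpa using hmem
  have edge_cases : ∀ e ∈ G.edgeSet, (∃ i, e = s(u i, v i)) ∨ (∃ i, e = s(v i, u (i + 1))) ∨
      e ∈ (deleteVertices G (Set.range v)).edgeSet := by
    intro e
    induction e with
    | h a b =>
      intro hab
      rw [SimpleGraph.mem_edgeSet] at hab
      by_cases ha : a ∈ Set.range v
      · obtain ⟨i, rfl⟩ := ha
        rcases nbr i b hab with rfl | rfl
        · exact .inl ⟨i, Sym2.eq_swap⟩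
        · exact .inr (.inl ⟨i, rfl⟩)
      by_cases hb : b ∈ Set.range v
      · obtain ⟨i, rfl⟩ := hb
        rcases nbr i a hab.symm with rfl | rfl
        · exact .inl ⟨i, rfl⟩
        · exact .inr (.inl ⟨i, Sym2.eq_swap⟩)
      exact .inr (.inr ⟨hab, ha, hb⟩)
  have notMem_deleted : ∀ e ∈ (deleteVertices G (Set.range v)).edgeSet, ∀ i, v i ∉ e := by
    intro e
    induction e with
    | h a b =>
      rintro ⟨-, ha, hb⟩ i hi
      rcases Sym2.mem_iff.1 hi with rfl | rfl
      exacts [ha ⟨i, rfl⟩, hb ⟨i, rfl⟩]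
  let c : Sym2 V → ℕ := fun e =>
    if h : ∃ i, e = s(u i, v i) then x h.choose
    else if h : ∃ i, e = s(v i, u (i + 1)) then y h.choose
    else c' e
  have c_left : ∀ i, c s(u i, v i) = x i := by
    intro i
    have h : ∃ j, s(u i, v i) = s(u j, v j) := ⟨i, rfl⟩
    have index_eq : ∀ j, s(u i, v i) = s(u j, v j) → j = i := by
      intro j hj
      simp only [Sym2.eq_iff, huv, false_and, or_false] at hj
      exact (hu hj.1).symm
    simp only [c, dif_pos h, index_eq _ h.choose_spec]
  have c_right : ∀ i, c s(v i, u (i + 1)) = y i := by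
    intro i
    have h : ∃ j, s(v i, u (i + 1)) = s(v j, u (j + 1)) := ⟨i, rfl⟩
    have hne : ¬ ∃ j, s(v i, u (i + 1)) = s(u j, v j) := by
      rintro ⟨j, hj⟩
      simp only [Sym2.eq_iff, huv, and_false, false_or] at hj
      obtain rfl := hv hj.1
      exact succ_ne _ (hu hj.2).symm
    have index_eq : ∀ j, s(v i, u (i + 1)) = s(v j, u (j + 1)) → j = i := by
      intro j hj
      simp only [Sym2.eq_iff, huv, and_false, or_false] at hj
      exact (hv hj.1).symm
    simp only [c, dif_neg hne, dif_pos h, index_eq _ h.choose_spec]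
  have c_deleted : ∀ e ∈ (deleteVertices G (Set.range v)).edgeSet, c e = c' e := by
    intro e he
    have h₁ : ¬ ∃ i, e = s(u i, v i) := by
      rintro ⟨i, rfl⟩
      exact notMem_deleted _ he i (Sym2.mem_mk_right _ _)
    have h₂ : ¬ ∃ i, e = s(v i, u (i + 1)) := by
      rintro ⟨i, rfl⟩
      exact notMem_deleted _ he i (Sym2.mem_mk_left _ _)
    simp only [c, dif_neg h₁, dif_neg h₂]
  have left_left : ∀ i j, s(u i, v i) ≠ s(u j, v j) →
      ¬ ∃ w, w ∈ s(u i, v i) ∧ w ∈ s(u j, v j) := by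
    rintro i j hij ⟨w, hw, hw'⟩
    refine hij (congrArg (fun i => s(u i, v i)) ?_)
    rw [Sym2.mem_iff] at hw hw'
    rcases hw with rfl | rfl <;> rcases hw' with h | h
    exacts [hu h, (huv _ _ h).elim, (huv _ _ h.symm).elim, hv h]
  have right_right : ∀ i j, s(v i, u (i + 1)) ≠ s(v j, u (j + 1)) →
      ¬ ∃ w, w ∈ s(v i, u (i + 1)) ∧ w ∈ s(v j, u (j + 1)) := by
    rintro i j hij ⟨w, hw, hw'⟩
    refine hij (congrArg (fun i => s(v i, u (i + 1))) ?_)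
    rw [Sym2.mem_iff] at hw hw'
    rcases hw with rfl | rfl <;> rcases hw' with h | h
    exacts [hv h, (huv _ _ h.symm).elim, (huv _ _ h).elim, add_right_cancel (hu h)]
  have left_right : ∀ i j, (∃ w, w ∈ s(u i, v i) ∧ w ∈ s(v j, u (j + 1))) → x i ≠ y j := by
    rintro i j ⟨w, hw, hw'⟩
    rw [Sym2.mem_iff] at hw hw'
    rcases hw with rfl | rfl <;> rcases hw' with h | h
    · exact (huv _ _ h).elim
    · rw [hu h]
      exact (hyx j).symm
    · rw [hv h]
      exact hxy j
    · exact (huv _ _ h.symm).elim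
  have avail_ne : ∀ w a, (∀ z, G.Adj w z → z ∉ Set.range v → c' s(w, z) ≠ a) →
      ∀ e ∈ (deleteVertices G (Set.range v)).edgeSet, w ∈ e → c' e ≠ a := by
    rintro w a h e he hw
    obtain ⟨z, rfl⟩ := hw
    exact h z he.1 he.2.2
  have left_deleted : ∀ i, ∀ e ∈ (deleteVertices G (Set.range v)).edgeSet,
      (∃ w, w ∈ s(u i, v i) ∧ w ∈ e) → c' e ≠ x i := by
    rintro i e he ⟨w, hw, hw'⟩
    rcases Sym2.mem_iff.1 hw with rfl | rfl
    · exact avail_ne _ _ (hx i).2 e he hw'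
    · exact (notMem_deleted e he _ hw').elim
  have right_deleted : ∀ i, ∀ e ∈ (deleteVertices G (Set.range v)).edgeSet,
      (∃ w, w ∈ s(v i, u (i + 1)) ∧ w ∈ e) → c' e ≠ y i := by
    rintro i e he ⟨w, hw, hw'⟩
    rcases Sym2.mem_iff.1 hw with rfl | rfl
    · exact (notMem_deleted e he _ hw').elim
    · exact avail_ne _ _ (hy i).2 e he hw'
  refine ⟨c, ⟨fun e he => ?_, fun e he f hf hef hw => ?_⟩, c_deleted⟩
  · rcases edge_cases e he with ⟨i, rfl⟩ | ⟨i, rfl⟩ | he'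
    · rw [c_left]
      exact (hx i).1
    · rw [c_right]
      exact (hy i).1
    · rw [c_deleted e he']
      exact hc'.1 e he'
  · have hw' : ∃ w, w ∈ f ∧ w ∈ e := hw.imp fun _ => And.symm
    rcases edge_cases e he with ⟨i, rfl⟩ | ⟨i, rfl⟩ | he' <;>
      rcases edge_cases f hf with ⟨j, rfl⟩ | ⟨j, rfl⟩ | hf'
    · exact (left_left i j hef hw).elim
    · rw [c_left, c_right]
      exact left_right i j hw
    · rw [c_left, c_deleted f hf']
      exact (left_deleted i f hf' hw).symm
    · rw [c_left, c_right]
      exact (left_right j i hw').symm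
    · exact (right_right i j hef hw).elim
    · rw [c_right, c_deleted f hf']
      exact (right_deleted i f hf' hw).symm
    · rw [c_left, c_deleted e he']
      exact left_deleted j e he' hw'
    · rw [c_right, c_deleted e he']
      exact right_deleted j e he' hw'
    · rw [c_deleted e he', c_deleted f hf']
      exact hc'.2 e he' f hf' hef hw
end

section
/- Let k ≥ 7 be a natural number and let G be a finite simple graph with maximum degree at most k. Suppose G contains 2p pairwise distinct vertices u_1, v_1, u_2, v_2, …, u_p, v_p with p ≥ 2 forming a cycle, i.e., u_i v_i and v_i u_{i+1} are edges of G for all i (indices modulo p), and suppose every v_i has degree exactly 2 in G. Let L be a list assignment on the vertices and edges of G with |L(x)| ≥ k + 1 for every vertex and every edge x. If the graph obtained from G by deleting the vertices v_1, …, v_p admits a proper L-total-coloring, then G admits a proper L-total-coloring. -/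
/-- A proper `L`-total-coloring of `G`: every vertex gets a color from its list,
every edge of `G` gets a color from its list, adjacent vertices receive distinct
colors, distinct edges sharing an endpoint receive distinct colors, and every edge
receives a color distinct from the colors of both of its endpoints. -/
def IsProperTotalColoring {V : Type*} (G : SimpleGraph V)
    (Lv : V → Finset ℕ) (Le : Sym2 V → Finset ℕ)
    (cv : V → ℕ) (ce : Sym2 V → ℕ) : Prop :=
  (∀ v, cv v ∈ Lv v) ∧
  (∀ e ∈ G.edgeSet, ce e ∈ Le e) ∧
  (∀ x y, G.Adj x y → cv x ≠ cv y) ∧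
  (∀ e ∈ G.edgeSet, ∀ f ∈ G.edgeSet, e ≠ f → (∃ x, x ∈ e ∧ x ∈ f) → ce e ≠ ce f) ∧
  (∀ e ∈ G.edgeSet, ∀ x ∈ e, ce e ≠ cv x)

/-- Greedy list coloring of an even cycle, given as alternating items `A i`, `B i`, that starts
with a color missing from the list of the last item. -/
lemma exists_cycle_list_coloring_of_mem_of_notMem {p : ℕ} [NeZero p] (A B : ZMod p → Finset ℕ)
    (hA : ∀ i, 2 ≤ (A i).card) (hB : ∀ i, 2 ≤ (B i).card)
    (s : ZMod p) (x : ℕ) (hx : x ∈ A (s + 1)) (hx' : x ∉ B s) :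
    ∃ a b : ZMod p → ℕ, (∀ i, a i ∈ A i) ∧ (∀ i, b i ∈ B i) ∧ (∀ i, a i ≠ b i) ∧
      ∀ i, b i ≠ a (i + 1) := by
  choose f hf hfne using fun i y => Finset.exists_mem_ne (hA i) y
  choose g hg hgne using fun i y => Finset.exists_mem_ne (hB i) y
  let c : ℕ → ℕ := fun m =>
    Nat.rec x (fun m y => f (s + 1 + (m + 1 : ℕ)) (g (s + 1 + m) y)) m
  have hc : ∀ m : ℕ, c m ∈ A (s + 1 + m) := by
    intro m
    cases m with
    | zero => simpa [c] using hx
    | succ m => exact hf _ _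
  have hcast : ∀ i : ZMod p, s + 1 + ((i - (s + 1)).val : ZMod p) = i := by
    intro i
    rw [ZMod.natCast_zmod_val]
    ring
  refine ⟨fun i => c (i - (s + 1)).val, fun i => g i (c (i - (s + 1)).val), ?_, fun i => hg _ _,
    fun i => (hgne _ _).symm, ?_⟩
  · intro i
    simpa only [hcast] using hc (i - (s + 1)).val
  · intro i
    by_cases h : i = s
    · subst h
      intro he
      apply hx'
      have hcx : c (i + 1 - (i + 1)).val = x := by simp [c]
      rw [← hcx]
      simp only at he
      rw [← he]
      exact hg _ _
    · have hval : (i + 1 - (s + 1)).val = (i - (s + 1)).val + 1 := by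
        have hlt : (i - (s + 1)).val + 1 < p := by
          have h1 := ZMod.val_lt (i - (s + 1))
          by_contra h2
          have h3 : (i - (s + 1)).val + 1 = p := by omega
          have h4 := congrArg (Nat.cast : ℕ → ZMod p) h3
          rw [Nat.cast_add, ZMod.natCast_zmod_val, Nat.cast_one, ZMod.natCast_self] at h4
          exact h (by linear_combination h4)
        rw [← ZMod.val_natCast_of_lt hlt, Nat.cast_add, ZMod.natCast_zmod_val]
        congr 1
        push_cast
        ring
      have hstep : c ((i - (s + 1)).val + 1) =
          f (s + 1 + ((i - (s + 1)).val + 1 : ℕ))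
            (g (s + 1 + ((i - (s + 1)).val : ℕ)) (c (i - (s + 1)).val)) := rfl
      simp only [hval, hstep]
      rw [hcast]
      exact (hfne _ _).symm

/-- Even cycles are 2-choosable. -/
lemma exists_even_cycle_list_coloring {p : ℕ} [NeZero p] (A B : ZMod p → Finset ℕ)
    (hA : ∀ i, 2 ≤ (A i).card) (hB : ∀ i, 2 ≤ (B i).card) :
    ∃ a b : ZMod p → ℕ, (∀ i, a i ∈ A i) ∧ (∀ i, b i ∈ B i) ∧ (∀ i, a i ≠ b i) ∧
      ∀ i, b i ≠ a (i + 1) := by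
  by_cases h₁ : ∀ i, A (i + 1) ⊆ B i
  · by_cases h₂ : ∀ i, B i ⊆ A i
    · have hge : ∀ n : ℕ, A 0 ⊆ A (-n) := by
        intro n
        induction n with
        | zero => simp
        | succ n ih =>
          have h := (h₁ (-(n + 1 : ℕ))).trans (h₂ _)
          have he : -((n + 1 : ℕ) : ZMod p) + 1 = -n := by push_cast; ring
          rw [he] at h
          exact ih.trans h
      have hge' : ∀ i, A 0 ⊆ A i := fun i => by simpa using hge (-i).val
      obtain ⟨x, hx, y, hy, hxy⟩ := Finset.one_lt_card.mp (hA 0)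
      exact ⟨fun _ => x, fun _ => y, fun i => hge' i hx, fun i => h₁ i (hge' _ hy),
        fun _ => hxy, fun _ => hxy.symm⟩
    · push Not at h₂
      obtain ⟨s, hs⟩ := h₂
      obtain ⟨x, hx, hx'⟩ := Finset.not_subset.mp hs
      obtain ⟨a, b, ha, hb, hab, hba⟩ := exists_cycle_list_coloring_of_mem_of_notMem
        (fun i => B (i - 1)) A (fun i => hB _) hA s x (by simpa using hx) hx'
      refine ⟨b, fun i => a (i + 1), hb, fun i => by simpa using ha (i + 1), hba,
        fun i => hab (i + 1)⟩
  · push Not at h₁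
    obtain ⟨s, hs⟩ := h₁
    obtain ⟨x, hx, hx'⟩ := Finset.not_subset.mp hs
    exact exists_cycle_list_coloring_of_mem_of_notMem A B hA hB s x hx hx'

theorem stmt_3 {V : Type*} [Fintype V] [DecidableEq V]
    (G : SimpleGraph V) [DecidableRel G.Adj]
    (k : ℕ) (hk : 7 ≤ k) (hΔ : ∀ w, G.degree w ≤ k)
    (p : ℕ) (hp : 2 ≤ p) (u v : ZMod p → V)
    (hu : Function.Injective u) (hv : Function.Injective v)
    (huv : ∀ i j, u i ≠ v j)
    (hadj : ∀ i : ZMod p, G.Adj (u i) (v i) ∧ G.Adj (v i) (u (i + 1)))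
    (hdeg : ∀ i, G.degree (v i) = 2)
    (Lv : V → Finset ℕ) (Le : Sym2 V → Finset ℕ)
    (hLv : ∀ w, k + 1 ≤ (Lv w).card)
    (hLe : ∀ e ∈ G.edgeSet, k + 1 ≤ (Le e).card)
    (h : ∃ cv ce, IsProperTotalColoring (deleteVertices G (Set.range v)) Lv Le cv ce) :
    ∃ cv ce, IsProperTotalColoring G Lv Le cv ce := by
  obtain ⟨cv, ce, hcv, hce, hvv, hee, hev⟩ := h
  have : NeZero p := ⟨by omega⟩
  have : Fact (1 < p) := ⟨by omega⟩
  have hsucc : ∀ i : ZMod p, i ≠ i + 1 := fun i hi => one_ne_zero (left_eq_add.mp hi)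
  have hnbr : ∀ i w, G.Adj (v i) w → w = u i ∨ w = u (i + 1) := by
    intro i w hw
    have hsub : ({u i, u (i + 1)} : Finset V) ⊆ G.neighborFinset (v i) := by
      intro z hz
      rw [Finset.mem_insert, Finset.mem_singleton] at hz
      rw [SimpleGraph.mem_neighborFinset]
      rcases hz with rfl | rfl
      exacts [(hadj i).1.symm, (hadj i).2]
    have heq := Finset.eq_of_subset_of_card_le hsub (by
      rw [SimpleGraph.card_neighborFinset_eq_degree, hdeg,
        Finset.card_pair (fun he => hsucc i (hu he))])
    have hmem : w ∈ G.neighborFinset (v i) := by simpa using hw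
    simpa [← heq] using hmem
  -- Colors already present at `u j`.
  let F : ZMod p → Finset ℕ := fun j => insert (cv (u j))
    ((G.neighborFinset (u j) \ {v j, v (j - 1)}).image fun w => ce s(u j, w))
  have hF : ∀ j, (F j).card + 1 ≤ k := by
    intro j
    have hsub : ({v j, v (j - 1)} : Finset V) ⊆ G.neighborFinset (u j) := by
      intro z hz
      rw [Finset.mem_insert, Finset.mem_singleton] at hz
      rw [SimpleGraph.mem_neighborFinset]
      rcases hz with rfl | rfl
      · exact (hadj j).1
      · simpa using (hadj (j - 1)).2.symm
    have hpair : ({v j, v (j - 1)} : Finset V).card = 2 :=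
      Finset.card_pair fun he => hsucc (j - 1) (by simpa using (hv he).symm)
    have h1 := Finset.card_insert_le (cv (u j))
      ((G.neighborFinset (u j) \ {v j, v (j - 1)}).image fun w => ce s(u j, w))
    have h2 := Finset.card_image_le (s := G.neighborFinset (u j) \ {v j, v (j - 1)})
      (f := fun w => ce s(u j, w))
    have h3 := Finset.card_sdiff_add_card_eq_card hsub
    have h4 := hΔ (u j)
    rw [SimpleGraph.card_neighborFinset_eq_degree] at h3
    change (insert _ _ : Finset ℕ).card + 1 ≤ k
    omega
  have havail : ∀ e ∈ G.edgeSet, ∀ j, 2 ≤ (Le e \ F j).card := by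
    intro e he j
    have h1 := Finset.le_card_sdiff (F j) (Le e)
    have h2 := hLe e he
    have h3 := hF j
    omega
  let ea : ZMod p → Sym2 V := fun i => s(u i, v i)
  let eb : ZMod p → Sym2 V := fun i => s(u (i + 1), v i)
  have hea : ∀ i, ea i ∈ G.edgeSet := fun i => (hadj i).1
  have heb : ∀ i, eb i ∈ G.edgeSet := fun i => (hadj i).2.symm
  obtain ⟨a, b, ha, hb, hab, hba⟩ := exists_even_cycle_list_coloring
    (fun i => Le (ea i) \ F i) (fun i => Le (eb i) \ F (i + 1))
    (fun i => havail _ (hea i) _) (fun i => havail _ (heb i) _)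
  simp only [Finset.mem_sdiff] at ha hb
  have hd : ∀ i, ∃ d ∈ Lv (v i), d ∉ ({cv (u i), cv (u (i + 1)), a i, b i} : Finset ℕ) := by
    intro i
    apply Finset.exists_mem_notMem_of_card_lt_card
    have h1 := Finset.card_le_four (a := cv (u i)) (b := cv (u (i + 1))) (c := a i) (d := b i)
    have h2 := hLv (v i)
    omega
  choose d hd hd' using hd
  simp only [Finset.mem_insert, Finset.mem_singleton, not_or] at hd'
  have hinj : Function.Injective (Sum.elim ea eb) := by
    rintro (i | i) (j | j) hij
    · have hij' : s(u i, v i) = s(u j, v j) := hij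
      rcases Sym2.eq_iff.mp hij' with h | h
      · rw [hu h.1]
      · exact absurd h.1 (huv _ _)
    · have hij' : s(u i, v i) = s(u (j + 1), v j) := hij
      rcases Sym2.eq_iff.mp hij' with h | h
      · exact absurd ((hv h.2).symm.trans (hu h.1)) (hsucc j)
      · exact absurd h.1 (huv _ _)
    · have hij' : s(u (i + 1), v i) = s(u j, v j) := hij
      rcases Sym2.eq_iff.mp hij' with h | h
      · exact absurd ((hv h.2).trans (hu h.1).symm) (hsucc i)
      · exact absurd h.1 (huv _ _)
    · have hij' : s(u (i + 1), v i) = s(u (j + 1), v j) := hij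
      rcases Sym2.eq_iff.mp hij' with h | h
      · rw [hv h.2]
      · exact absurd h.1 (huv _ _)
  let cv' : V → ℕ := Function.extend v d cv
  let ce' : Sym2 V → ℕ := Function.extend (Sum.elim ea eb) (Sum.elim a b) ce
  have hcv_v : ∀ i, cv' (v i) = d i := fun i => hv.extend_apply _ _ _
  have hcv_of : ∀ w, w ∉ Set.range v → cv' w = cv w := fun w hw =>
    Function.extend_apply' _ _ _ hw
  have hcv_u : ∀ i, cv' (u i) = cv (u i) := fun i =>
    hcv_of _ fun ⟨j, hj⟩ => huv i j hj.symm
  have hce_a : ∀ i, ce' (ea i) = a i := fun i => hinj.extend_apply _ _ (Sum.inl i)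
  have hce_b : ∀ i, ce' (eb i) = b i := fun i => hinj.extend_apply _ _ (Sum.inr i)
  have hH : ∀ e ∈ (deleteVertices G (Set.range v)).edgeSet,
      e ∈ G.edgeSet ∧ ∀ i, v i ∉ e := by
    intro e
    induction e using Sym2.ind with
    | _ x y =>
      rintro ⟨hxy, hx, hy⟩
      refine ⟨hxy, fun i hi => ?_⟩
      rcases Sym2.mem_iff.mp hi with rfl | rfl
      exacts [hx ⟨i, rfl⟩, hy ⟨i, rfl⟩]
  have hce_of : ∀ e ∈ (deleteVertices G (Set.range v)).edgeSet, ce' e = ce e := by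
    intro e he
    refine Function.extend_apply' _ _ _ ?_
    rintro ⟨i | i, rfl⟩
    · exact (hH _ he).2 i (Sym2.mem_mk_right _ _)
    · exact (hH _ he).2 i (Sym2.mem_mk_right _ _)
  have hedge : ∀ e ∈ G.edgeSet, e ∈ (deleteVertices G (Set.range v)).edgeSet ∨
      (∃ i, e = ea i) ∨ ∃ i, e = eb i := by
    have hvw : ∀ i w, G.Adj (v i) w → (∃ j, s(w, v i) = ea j) ∨ ∃ j, s(w, v i) = eb j := by
      intro i w hw
      rcases hnbr i w hw with rfl | rfl
      exacts [Or.inl ⟨i, rfl⟩, Or.inr ⟨i, rfl⟩]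
    intro e
    induction e using Sym2.ind with
    | _ x y =>
      intro hxy
      by_cases hx : x ∈ Set.range v
      · obtain ⟨i, rfl⟩ := hx
        rw [Sym2.eq_swap]
        exact Or.inr (hvw i y hxy)
      by_cases hy : y ∈ Set.range v
      · obtain ⟨i, rfl⟩ := hy
        exact Or.inr (hvw i x (SimpleGraph.Adj.symm hxy))
      exact Or.inl ⟨hxy, hx, hy⟩
  have hmemF : ∀ e ∈ (deleteVertices G (Set.range v)).edgeSet, ∀ j, u j ∈ e → ce e ∈ F j := by
    intro e he j hj
    obtain ⟨w, rfl⟩ := hj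
    have hw := hH _ he
    refine Finset.mem_insert_of_mem (Finset.mem_image_of_mem (fun w => ce s(u j, w)) ?_)
    have hwv : ∀ i, w ≠ v i := by
      rintro i rfl
      exact hw.2 i (Sym2.mem_mk_right _ _)
    have hadj' : G.Adj (u j) w := hw.1
    simp [hadj', hwv]
  have hHa : ∀ e ∈ (deleteVertices G (Set.range v)).edgeSet, ∀ i,
      (∃ x, x ∈ e ∧ x ∈ ea i) → ce' e ≠ ce' (ea i) := by
    rintro e he i ⟨x, hxe, hx⟩ heq
    rw [hce_of e he, hce_a] at heq
    rcases Sym2.mem_iff.mp hx with rfl | rfl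
    · exact (ha i).2 (heq ▸ hmemF e he i hxe)
    · exact (hH e he).2 i hxe
  have hHb : ∀ e ∈ (deleteVertices G (Set.range v)).edgeSet, ∀ i,
      (∃ x, x ∈ e ∧ x ∈ eb i) → ce' e ≠ ce' (eb i) := by
    rintro e he i ⟨x, hxe, hx⟩ heq
    rw [hce_of e he, hce_b] at heq
    rcases Sym2.mem_iff.mp hx with rfl | rfl
    · exact (hb i).2 (heq ▸ hmemF e he (i + 1) hxe)
    · exact (hH e he).2 i hxe
  have hAB : ∀ i j, (∃ x, x ∈ ea i ∧ x ∈ eb j) → ce' (ea i) ≠ ce' (eb j) := by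
    rintro i j ⟨x, hxa, hxb⟩
    rw [hce_a, hce_b]
    rcases Sym2.mem_iff.mp hxa with rfl | rfl <;> rcases Sym2.mem_iff.mp hxb with h | h
    · rw [hu h]
      exact (hba j).symm
    · exact absurd h (huv _ _)
    · exact absurd h.symm (huv _ _)
    · rw [hv h]
      exact hab j
  have hcomm : ∀ {e f : Sym2 V}, (∃ x, x ∈ e ∧ x ∈ f) → ∃ x, x ∈ f ∧ x ∈ e :=
    fun ⟨x, h1, h2⟩ => ⟨x, h2, h1⟩
  have hvne : ∀ i w, G.Adj (v i) w → cv' (v i) ≠ cv' w := by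
    intro i w hw
    rcases hnbr i w hw with rfl | rfl
    · rw [hcv_v, hcv_u]
      exact (hd' i).1
    · rw [hcv_v, hcv_u]
      exact (hd' i).2.1
  refine ⟨cv', ce', ?_, ?_, ?_, ?_, ?_⟩
  · intro w
    by_cases hw : w ∈ Set.range v
    · obtain ⟨i, rfl⟩ := hw
      rw [hcv_v]
      exact hd i
    · rw [hcv_of w hw]
      exact hcv w
  · intro e he
    rcases hedge e he with h | ⟨i, rfl⟩ | ⟨i, rfl⟩
    · rw [hce_of e h]
      exact hce e h
    · rw [hce_a]
      exact (ha i).1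
    · rw [hce_b]
      exact (hb i).1
  · intro x y hxy
    by_cases hx : x ∈ Set.range v
    · obtain ⟨i, rfl⟩ := hx
      exact hvne i y hxy
    by_cases hy : y ∈ Set.range v
    · obtain ⟨i, rfl⟩ := hy
      exact (hvne i x hxy.symm).symm
    rw [hcv_of x hx, hcv_of y hy]
    exact hvv x y ⟨hxy, hx, hy⟩
  · intro e he f hf hef hx
    rcases hedge e he with h | ⟨i, rfl⟩ | ⟨i, rfl⟩ <;>
      rcases hedge f hf with h' | ⟨j, rfl⟩ | ⟨j, rfl⟩
    · rw [hce_of e h, hce_of f h']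
      exact hee e h f h' hef hx
    · exact hHa e h j hx
    · exact hHb e h j hx
    · exact (hHa f h' i (hcomm hx)).symm
    · obtain ⟨x, hxi, hxj⟩ := hx
      exfalso
      rcases Sym2.mem_iff.mp hxi with rfl | rfl <;> rcases Sym2.mem_iff.mp hxj with h | h
      · exact hef (by rw [hu h])
      · exact huv _ _ h
      · exact huv _ _ h.symm
      · exact hef (by rw [hv h])
    · exact hAB i j hx
    · exact (hHb f h' i (hcomm hx)).symm
    · exact (hAB j i (hcomm hx)).symm
    · obtain ⟨x, hxi, hxj⟩ := hx
      exfalso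
      rcases Sym2.mem_iff.mp hxi with rfl | rfl <;> rcases Sym2.mem_iff.mp hxj with h | h
      · exact hef (by rw [add_right_cancel (hu h)])
      · exact huv _ _ h
      · exact huv _ _ h.symm
      · exact hef (by rw [hv h])
  · intro e he x hx
    rcases hedge e he with h | ⟨i, rfl⟩ | ⟨i, rfl⟩
    · have hxv : x ∉ Set.range v := by
        rintro ⟨i, rfl⟩
        exact (hH e h).2 i hx
      rw [hce_of e h, hcv_of x hxv]
      exact hev e h x hx
    · rw [hce_a]
      rcases Sym2.mem_iff.mp hx with rfl | rfl
      · rw [hcv_u]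
        exact fun heq => (ha i).2 (heq ▸ Finset.mem_insert_self _ _)
      · rw [hcv_v]
        exact (Ne.symm (hd' i).2.2.1)
    · rw [hce_b]
      rcases Sym2.mem_iff.mp hx with rfl | rfl
      · rw [hcv_u]
        exact fun heq => (hb i).2 (heq ▸ Finset.mem_insert_self _ _)
      · rw [hcv_v]
        exact (Ne.symm (hd' i).2.2.2)
end

section
/- Let k ≥ 7 be a natural number and let G be a finite simple graph with maximum degree at most k. Suppose G contains pairwise distinct vertices u, v_1, …, v_{p+1}, x_1, …, x_p with p ≥ 1 such that: every v_i (1 ≤ i ≤ p+1) is adjacent to u; v_i x_i and x_i v_{i+1} are edges of G for all 1 ≤ i ≤ p; d(v_1) = d(v_{p+1}) = 2; and d(v_i) = 3 for all 2 ≤ i ≤ p. Let L be a list assignment on the edges of G with |L(e)| ≥ k for every edge e. Then every proper L-edge-coloring of the graph obtained from G by deleting the vertices v_1, …, v_{p+1} extends to a proper L-edge-coloring of G (agreeing with the given coloring on all edges not incident to any v_i). -/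
/-- In a finite family `S` of edges of a bipartite multigraph (with end maps `f` and `g`), where the
edges at each vertex are linearly ranked by `r` on one side and `q` on the other, there is a
stable matching. -/
theorem exists_stable_matching {E A B : Type*} [DecidableEq E] (f : E → A) (g : E → B)
    (r q : E → ℕ) (hq : ∀ e e', g e = g e' → q e = q e' → e = e')
    (hr : ∀ e e', f e = f e' → r e = r e' → e = e') (S : Finset E) :
    ∃ K ⊆ S, (∀ e ∈ K, ∀ e' ∈ K, e ≠ e' → f e ≠ f e' ∧ g e ≠ g e') ∧
      ∀ e ∈ S, e ∉ K → ∃ e' ∈ K,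
        (f e' = f e ∧ r e' < r e) ∨ (g e' = g e ∧ q e' < q e) := by
  classical
  induction S using Finset.strongInduction with
  | H S ih =>
  by_cases hcol : ∃ e ∈ S, ∃ e' ∈ S, (∀ d ∈ S, f d = f e → r e ≤ r d) ∧
      (∀ d ∈ S, f d = f e' → r e' ≤ r d) ∧ g e = g e' ∧ q e < q e'
  · obtain ⟨e, he, e', he', hbest, -, hg, hlt⟩ := hcol
    obtain ⟨K, hKS, hmatch, hdom⟩ := ih (S.erase e') (Finset.erase_ssubset he')
    refine ⟨K, hKS.trans (Finset.erase_subset _ _), hmatch, fun d hd hdK => ?_⟩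
    by_cases hde : d = e'
    · subst hde
      by_cases heK : e ∈ K
      · exact ⟨e, heK, Or.inr ⟨hg, hlt⟩⟩
      · obtain ⟨z, hzK, hz⟩ :=
          hdom e (Finset.mem_erase.2 ⟨fun h => by subst h; omega, he⟩) heK
        rcases hz with ⟨hfz, hrz⟩ | ⟨hgz, hqz⟩
        · have := hbest z (Finset.mem_of_mem_erase (hKS hzK)) hfz
          omega
        · exact ⟨z, hzK, Or.inr ⟨hgz.trans hg, hqz.trans hlt⟩⟩
    · exact hdom d (Finset.mem_erase.2 ⟨hde, hd⟩) hdK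
  · push Not at hcol
    refine ⟨S.filter fun e => ∀ d ∈ S, f d = f e → r e ≤ r d, Finset.filter_subset _ _, ?_, ?_⟩
    · intro e he e' he' hne
      simp only [Finset.mem_filter] at he he'
      refine ⟨fun hf => hne (hr e e' hf ?_), fun hg => hne (hq e e' hg ?_)⟩
      · exact le_antisymm (he.2 e' he'.1 hf.symm) (he'.2 e he.1 hf)
      · exact le_antisymm (hcol e' he'.1 e he.1 he'.2 he.2 hg.symm)
          (hcol e he.1 e' he'.1 he.2 he'.2 hg)
    · intro e he heK
      obtain ⟨m, hm, hmin⟩ := Finset.exists_min_image (S.filter fun d => f d = f e) r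
        ⟨e, by simp [he]⟩
      simp only [Finset.mem_filter] at hm hmin
      have hmK : ∀ d ∈ S, f d = f m → r m ≤ r d :=
        fun d hd hdm => hmin d ⟨hd, hdm.trans hm.2⟩
      refine ⟨m, by simpa [hm.1] using hmK, Or.inl ⟨hm.2, ?_⟩⟩
      refine lt_of_le_of_ne (hmin e ⟨he, rfl⟩) fun h => heK ?_
      have := hr m e hm.2 h
      subst this
      simpa [hm.1] using hmK

/-- The kernel method: if every subfamily has a `conf`-independent set dominating it, and each
list is larger than the number of elements dominating its owner, then a coloring from
the lists exists. -/
theorem exists_list_coloring_of_kernel {E : Type*} [DecidableEq E] (conf dom : E → E → Prop)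
    [DecidableRel dom]
    (hker : ∀ T : Finset E, ∃ K ⊆ T, (∀ e ∈ K, ∀ e' ∈ K, e ≠ e' → ¬ conf e e') ∧
      ∀ e ∈ T, e ∉ K → ∃ e' ∈ K, dom e' e)
    (S : Finset E) (L : E → Finset ℕ)
    (hL : ∀ e ∈ S, (S.filter fun e' => dom e' e).card < (L e).card) :
    ∃ c : E → ℕ, (∀ e ∈ S, c e ∈ L e) ∧
      ∀ e ∈ S, ∀ e' ∈ S, e ≠ e' → conf e e' → c e ≠ c e' := by
  induction S using Finset.strongInduction generalizing L with
  | H S ih =>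
  rcases S.eq_empty_or_nonempty with rfl | ⟨e₀, he₀⟩
  · exact ⟨fun _ => 0, by simp, by simp⟩
  obtain ⟨α, hα⟩ := Finset.card_pos.1 (Nat.zero_lt_of_lt (hL e₀ he₀))
  obtain ⟨K, hKT, hind, hdom⟩ := hker (S.filter fun e => α ∈ L e)
  have hKS : K ⊆ S := hKT.trans (Finset.filter_subset _ _)
  have hKne : K.Nonempty := by
    by_cases h : e₀ ∈ K
    · exact ⟨e₀, h⟩
    · obtain ⟨e, he, -⟩ := hdom e₀ (Finset.mem_filter.2 ⟨he₀, hα⟩) h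
      exact ⟨e, he⟩
  obtain ⟨c, hcL, hc⟩ := ih (S \ K) (Finset.sdiff_ssubset hKS hKne)
    (fun e => (L e).erase α) (by
      intro e he
      obtain ⟨heS, heK⟩ := Finset.mem_sdiff.1 he
      have hsub : ((S \ K).filter fun e' => dom e' e) ⊆ S.filter fun e' => dom e' e :=
        Finset.filter_subset_filter _ Finset.sdiff_subset
      by_cases hαe : α ∈ L e
      · obtain ⟨e', he'K, hd⟩ := hdom e (Finset.mem_filter.2 ⟨heS, hαe⟩) heK
        have hlt := Finset.card_lt_card (Finset.ssubset_iff_of_subset hsub |>.2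
          ⟨e', by simp [hKS he'K, hd], by simp [he'K]⟩)
        have := hL e heS
        rw [Finset.card_erase_of_mem hαe]
        omega
      · rw [Finset.erase_eq_of_notMem hαe]
        exact (Finset.card_le_card hsub).trans_lt (hL e heS))
  refine ⟨fun e => if e ∈ K then α else c e, fun e he => ?_, fun e he e' he' hne hconf => ?_⟩
  · by_cases h : e ∈ K
    · simpa [h] using (Finset.mem_filter.1 (hKT h)).2
    · simpa [h] using Finset.mem_of_mem_erase (hcL e (Finset.mem_sdiff.2 ⟨he, h⟩))
  · by_cases h : e ∈ K <;> by_cases h' : e' ∈ K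
    · exact absurd hconf (hind e h e' h' hne)
    · simpa [h, h'] using
        (Finset.ne_of_mem_erase (hcL e' (Finset.mem_sdiff.2 ⟨he', h'⟩))).symm
    · simpa [h, h'] using Finset.ne_of_mem_erase (hcL e (Finset.mem_sdiff.2 ⟨he, h⟩))
    · simpa [h, h'] using
        hc e (Finset.mem_sdiff.2 ⟨he, h⟩) e' (Finset.mem_sdiff.2 ⟨he', h'⟩) hne hconf

/-- Incidence in the fan: `(i, none)` stands for the edge from the `i`-th rim vertex to the hub and
`(i, some j)` for the edge from the `i`-th rim vertex to the `j`-th connecting vertex. -/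
def IsFanEdge {p : ℕ} (e : Fin (p + 1) × Option (Fin p)) : Prop :=
  ∀ j ∈ e.2, (e.1 : ℕ) = j ∨ (e.1 : ℕ) = j + 1

/-- Rank of a fan edge at its hub or connecting vertex; smaller is preferred. -/
def fanOuterRank {p : ℕ} : Fin (p + 1) × Option (Fin p) → ℕ
  | (i, none) => if (i : ℕ) = 0 then p else i - 1
  | (i, some _) => i

/-- Rank of a fan edge at its rim vertex; smaller is preferred. -/
def fanRimRank {p : ℕ} : Fin (p + 1) × Option (Fin p) → ℕ
  | (i, none) => if (i : ℕ) = 0 then 0 else p + 1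
  | (_, some j) => j + 1

/-- The edges of a fan can be colored from lists of size `p + 1` at the hub and `2` elsewhere. -/
theorem exists_fan_list_coloring {p : ℕ} (hp : 1 ≤ p)
    (A : Fin (p + 1) × Option (Fin p) → Finset ℕ)
    (hA : ∀ i, p + 1 ≤ (A (i, none)).card)
    (hA' : ∀ i j, IsFanEdge (i, some j) → 2 ≤ (A (i, some j)).card) :
    ∃ c : Fin (p + 1) × Option (Fin p) → ℕ, (∀ e, IsFanEdge e → c e ∈ A e) ∧
      ∀ e, IsFanEdge e → ∀ e', IsFanEdge e' → e ≠ e' → (e.2 = e'.2 ∨ e.1 = e'.1) →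
        c e ≠ c e' := by
  classical
  have hr : ∀ e e' : Fin (p + 1) × Option (Fin p), e.2 = e'.2 →
      fanOuterRank e = fanOuterRank e' → e = e' := by
    rintro ⟨i, _ | j⟩ ⟨i', _ | j'⟩ h h' <;> simp [-Fin.val_eq_zero_iff, fanOuterRank] at h h' ⊢
    · split_ifs at h' <;> omega
    · exact ⟨Fin.ext h', h⟩
  have hq : ∀ e e' : Fin (p + 1) × Option (Fin p), e.1 = e'.1 →
      fanRimRank e = fanRimRank e' → e = e' := by
    rintro ⟨i, _ | j⟩ ⟨i', _ | j'⟩ h h' <;> simp [-Fin.val_eq_zero_iff, fanRimRank] at h h' ⊢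
    · exact h
    · split_ifs at h' <;> omega
    · split_ifs at h' <;> omega
    · exact ⟨h, Fin.ext h'⟩
  obtain ⟨c, hcA, hc⟩ := exists_list_coloring_of_kernel
    (fun e e' : Fin (p + 1) × Option (Fin p) => e.2 = e'.2 ∨ e.1 = e'.1)
    (fun e' e => (e'.2 = e.2 ∧ fanOuterRank e' < fanOuterRank e) ∨
      (e'.1 = e.1 ∧ fanRimRank e' < fanRimRank e))
    (fun T => by
      obtain ⟨K, hKT, hK, hd⟩ := exists_stable_matching Prod.snd Prod.fst
        fanOuterRank fanRimRank hq hr T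
      exact ⟨K, hKT, fun e he e' he' hne => not_or.2 (hK e he e' he' hne), hd⟩)
    (Finset.univ.filter IsFanEdge) A (by
      rintro ⟨i, _ | j⟩ he
      · refine lt_of_lt_of_le (Nat.lt_succ_of_le ?_) (hA i)
        refine (Finset.card_le_card_of_injOn (t := Finset.range p)
          (fun e => e.2.elim ((e.1 : ℕ) - 1) fun j => (j : ℕ)) ?_ ?_).trans_eq
          (Finset.card_range p)
        · rintro ⟨i', _ | j'⟩ h
          · simp [-Fin.val_eq_zero_iff, fanOuterRank, fanRimRank] at h ⊢
            omega
          · simp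
        · intro e h e' h' hab
          replace h := Finset.mem_filter.1 (Finset.mem_coe.1 h)
          replace h' := Finset.mem_filter.1 (Finset.mem_coe.1 h')
          rcases e with ⟨a, _ | b⟩ <;> rcases e' with ⟨a', _ | b'⟩ <;>
            simp [-Fin.val_eq_zero_iff, fanOuterRank, fanRimRank, IsFanEdge] at h h' hab ⊢
          · split_ifs at h h' <;> omega
          · split_ifs at h h' <;> omega
          · split_ifs at h h' <;> omega
          · exact ⟨h.2.1.trans h'.2.1.symm, Fin.ext hab⟩
      · have hfan := (Finset.mem_filter.1 he).2
        refine lt_of_lt_of_le (Nat.lt_succ_of_le ?_) (hA' i j hfan)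
        rw [Finset.card_le_one]
        rintro ⟨a, _ | b⟩ h ⟨a', _ | b'⟩ h' <;>
          simp [-Fin.val_eq_zero_iff, fanOuterRank, fanRimRank, IsFanEdge] at h h' hfan ⊢
        · exact h.1.trans h'.1.symm
        · split_ifs at h <;> omega
        · split_ifs at h' <;> omega
        · simp only [Fin.ext_iff] at h h' ⊢
          omega)
  exact ⟨c, fun e he => hcA e (by simpa using he), fun e he e' he' =>
    hc e (by simpa using he) e' (by simpa using he')⟩

/-- Colors of `c` on the edges from `w` to vertices outside `D`. -/
def usedColors {V : Type*} [Fintype V] [DecidableEq V] (G : SimpleGraph V) [DecidableRel G.Adj]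
    (D : Finset V) (c : Sym2 V → ℕ) (w : V) : Finset ℕ :=
  (G.neighborFinset w \ D).image fun y => c s(w, y)

theorem card_add_card_usedColors_le {V : Type*} [Fintype V] [DecidableEq V] (G : SimpleGraph V)
    [DecidableRel G.Adj] (D T : Finset V) (c : Sym2 V → ℕ) (w : V)
    (hTD : T ⊆ D) (hT : T ⊆ G.neighborFinset w) :
    T.card + (usedColors G D c w).card ≤ G.degree w := by
  have h₁ : (usedColors G D c w).card ≤ (G.neighborFinset w \ T).card :=
    Finset.card_image_le.trans (Finset.card_le_card (Finset.sdiff_subset_sdiff le_rfl hTD))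
  have h₂ := Finset.card_sdiff_add_card_eq_card hT
  rw [G.card_neighborFinset_eq_degree] at h₂
  omega

/-- `v : Fin (p+1) → V` encodes the vertices `v_1, …, v_{p+1}` and
`x : Fin p → V` encodes the vertices `x_1, …, x_p` (zero-indexed). -/
theorem stmt_4 {V : Type*} [Fintype V] [DecidableEq V]
    (G : SimpleGraph V) [DecidableRel G.Adj]
    (k : ℕ) (hk : 7 ≤ k) (hΔ : ∀ w, G.degree w ≤ k)
    (p : ℕ) (hp : 1 ≤ p) (u : V) (v : Fin (p + 1) → V) (x : Fin p → V)
    (hv : Function.Injective v) (hx : Function.Injective x)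
    (huv : ∀ i, u ≠ v i) (hux : ∀ i, u ≠ x i) (hvx : ∀ i j, v i ≠ x j)
    (hadju : ∀ i : Fin (p + 1), G.Adj u (v i))
    (hadj : ∀ i : Fin p, G.Adj (v i.castSucc) (x i) ∧ G.Adj (x i) (v i.succ))
    (hdeg1 : G.degree (v 0) = 2) (hdeg2 : G.degree (v (Fin.last p)) = 2)
    (hdeg3 : ∀ i : Fin (p + 1), i ≠ 0 → i ≠ Fin.last p → G.degree (v i) = 3)
    (L : Sym2 V → Finset ℕ) (hL : ∀ e ∈ G.edgeSet, k ≤ (L e).card)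
    (c' : Sym2 V → ℕ)
    (hc' : IsProperEdgeColoring (deleteVertices G (Set.range v)) L c') :
    ∃ c : Sym2 V → ℕ, IsProperEdgeColoring G L c ∧
      ∀ e ∈ (deleteVertices G (Set.range v)).edgeSet, c e = c' e := by
  classical
  set D : Finset V := Finset.univ.image v with hD
  have hDmem : ∀ y, y ∈ D ↔ y ∈ Set.range v := by simp [hD]
  let w : Option (Fin p) → V := fun a => a.elim u x
  have hw : Function.Injective w := by
    rintro (_ | j) (_ | j') h
    · rfl
    · exact absurd h (hux j')
    · exact absurd h.symm (hux j)
    · exact congrArg some (hx h)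
  have hvw : ∀ i a, v i ≠ w a := by
    rintro i (_ | j)
    · exact (huv i).symm
    · exact hvx i j
  let edge : Fin (p + 1) × Option (Fin p) → Sym2 V := fun e => s(v e.1, w e.2)
  have hedge : Function.Injective edge := by
    rintro ⟨i, a⟩ ⟨i', a'⟩ h
    rcases Sym2.eq_iff.1 h with ⟨h₁, h₂⟩ | ⟨h₁, -⟩
    · exact Prod.ext (hv h₁) (hw h₂)
    · exact absurd h₁ (hvw i a')
  have hfanAdj : ∀ e, IsFanEdge e → G.Adj (v e.1) (w e.2) := by
    rintro ⟨i, _ | j⟩ he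
    · exact (hadju i).symm
    · rcases he j rfl with h | h
      · obtain rfl : i = j.castSucc := Fin.ext h
        exact (hadj j).1
      · obtain rfl : i = j.succ := Fin.ext h
        exact (hadj j).2.symm
  have hnbr : ∀ i y, G.Adj (v i) y → ∃ a, IsFanEdge (i, a) ∧ w a = y := by
    intro i
    suffices h : ∃ T : Finset (Option (Fin p)), (∀ a ∈ T, IsFanEdge (i, a)) ∧
        G.degree (v i) ≤ T.card by
      obtain ⟨T, hT, hcard⟩ := h
      have heq : T.image w = G.neighborFinset (v i) := by
        refine Finset.eq_of_subset_of_card_le (fun y hy => ?_) ?_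
        · obtain ⟨a, ha, rfl⟩ := Finset.mem_image.1 hy
          simpa using hfanAdj _ (hT a ha)
        · rwa [Finset.card_image_of_injective _ hw, G.card_neighborFinset_eq_degree]
      intro y hy
      obtain ⟨a, ha, rfl⟩ := Finset.mem_image.1 (heq ▸ (G.mem_neighborFinset _ _).2 hy)
      exact ⟨a, hT a ha, rfl⟩
    by_cases h0 : i = 0
    · subst h0
      exact ⟨{none, some ⟨0, hp⟩}, by simp [IsFanEdge], by simp [hdeg1]⟩
    by_cases hl : i = Fin.last p
    · subst hl
      refine ⟨{none, some ⟨p - 1, by omega⟩}, ?_, by simp [hdeg2]⟩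
      simp [IsFanEdge]
      omega
    · have h0' : (i : ℕ) ≠ 0 := fun h => h0 (Fin.ext h)
      have hl' : (i : ℕ) ≠ p := fun h => hl (Fin.ext h)
      have hi := i.isLt
      refine ⟨{none, some ⟨i - 1, by omega⟩, some ⟨i, by omega⟩}, ?_, ?_⟩
      · simp [IsFanEdge]
        omega
      · rw [hdeg3 i h0 hl, Finset.card_eq_three.2]
        exact ⟨_, _, _, by simp, by simp, by simp; omega, rfl⟩
  have hclass : ∀ e ∈ G.edgeSet, (∃ ε, IsFanEdge ε ∧ edge ε = e) ∨
      e ∈ (deleteVertices G (Set.range v)).edgeSet := by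
    intro e
    induction e using Sym2.ind with
    | _ a b =>
    intro hab
    by_cases ha : a ∈ Set.range v
    · obtain ⟨i, rfl⟩ := ha
      obtain ⟨a', ha', rfl⟩ := hnbr i b hab
      exact Or.inl ⟨(i, a'), ha', rfl⟩
    by_cases hb : b ∈ Set.range v
    · obtain ⟨i, rfl⟩ := hb
      obtain ⟨a', ha', rfl⟩ := hnbr i a hab.symm
      exact Or.inl ⟨(i, a'), ha', Sym2.eq_swap⟩
    · exact Or.inr ⟨hab, ha, hb⟩
  have hold : ∀ e ∈ (deleteVertices G (Set.range v)).edgeSet, ∀ z ∈ e,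
      z ∉ Set.range v ∧ c' e ∈ usedColors G D c' z := by
    intro e
    induction e using Sym2.ind with
    | _ a b =>
    rintro ⟨hab, ha, hb⟩ z hz
    rcases Sym2.mem_iff.1 hz with rfl | rfl
    · exact ⟨ha, Finset.mem_image.2 ⟨b, by simp [hab, hDmem, -Set.mem_range, hb], rfl⟩⟩
    · exact ⟨hb, Finset.mem_image.2
        ⟨a, by simp [hab.symm, hDmem, -Set.mem_range, ha], by rw [Sym2.eq_swap]⟩⟩
  have hcard : ∀ (e : Fin (p + 1) × Option (Fin p)) (T : Finset V), IsFanEdge e → T ⊆ D →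
      T ⊆ G.neighborFinset (w e.2) →
      T.card ≤ (L (edge e) \ usedColors G D c' (w e.2)).card := by
    intro e T he hTD hT
    have h₁ := card_add_card_usedColors_le G D T c' (w e.2) hTD hT
    have h₂ := hΔ (w e.2)
    have h₃ := hL (edge e) (hfanAdj e he)
    have h₄ := Finset.le_card_sdiff (usedColors G D c' (w e.2)) (L (edge e))
    omega
  obtain ⟨γ, hγL, hγ⟩ := exists_fan_list_coloring hp
    (fun e => L (edge e) \ usedColors G D c' (w e.2))
    (fun i => by
      have := hcard (i, none) D (by simp [IsFanEdge]) le_rfl (fun y hy => by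
        obtain ⟨i', rfl⟩ := (hDmem y).1 hy
        exact (G.mem_neighborFinset _ _).2 (hadju i'))
      simpa [hD, Finset.card_image_of_injective _ hv] using this)
    (fun i j hij => by
      have := hcard (i, some j) {v j.castSucc, v j.succ} hij
        (by intro y; simp [hDmem]; rintro (rfl | rfl) <;> simp)
        (by
          intro y
          simp only [Finset.mem_insert, Finset.mem_singleton, SimpleGraph.mem_neighborFinset]
          rintro (rfl | rfl)
          · exact (hadj j).1.symm
          · exact (hadj j).2)
      rwa [Finset.card_pair (fun h => by simpa [Fin.ext_iff] using hv h)] at this)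
  have hnew : ∀ e, Function.extend edge γ c' (edge e) = γ e := hedge.extend_apply γ c'
  have hkeep : ∀ e ∈ (deleteVertices G (Set.range v)).edgeSet,
      Function.extend edge γ c' e = c' e := by
    intro e he
    refine Function.extend_apply' _ _ _ ?_
    rintro ⟨ε, rfl⟩
    exact (hold _ he (v ε.1) (Sym2.mem_mk_left _ _)).1 ⟨_, rfl⟩
  have hcross : ∀ ε, IsFanEdge ε → ∀ f ∈ (deleteVertices G (Set.range v)).edgeSet,
      (∃ z, z ∈ edge ε ∧ z ∈ f) → γ ε ≠ c' f := by
    rintro ε hε f hf ⟨z, hzε, hzf⟩ heq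
    obtain ⟨hz, hused⟩ := hold f hf z hzf
    rcases Sym2.mem_iff.1 hzε with rfl | rfl
    · exact hz ⟨_, rfl⟩
    · exact (Finset.mem_sdiff.1 (hγL ε hε)).2 (heq ▸ hused)
  refine ⟨Function.extend edge γ c', ⟨fun e he => ?_, fun e he f hf hne hz => ?_⟩, hkeep⟩
  · rcases hclass e he with ⟨ε, hε, rfl⟩ | h
    · rw [hnew]
      exact (Finset.mem_sdiff.1 (hγL ε hε)).1
    · rw [hkeep e h]
      exact hc'.1 e h
  · rcases hclass e he with ⟨ε, hε, rfl⟩ | h <;> rcases hclass f hf with ⟨φ, hφ, rfl⟩ | h'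
    · rw [hnew, hnew]
      refine hγ ε hε φ hφ (fun h => hne (h ▸ rfl)) ?_
      obtain ⟨z, hz₁, hz₂⟩ := hz
      rcases Sym2.mem_iff.1 hz₁ with rfl | rfl <;> rcases Sym2.mem_iff.1 hz₂ with h | h
      · exact Or.inr (hv h)
      · exact absurd h (hvw _ _)
      · exact absurd h.symm (hvw _ _)
      · exact Or.inl (hw h)
    · rw [hnew, hkeep f h']
      exact hcross ε hε f h' hz
    · rw [hnew, hkeep e h]
      exact (hcross φ hφ e h (hz.imp fun _ => And.symm)).symm
    · rw [hkeep e h, hkeep f h']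
      exact hc'.2 e h f h' hne hz
end
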